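/- Let H be a real Hilbert space, C a nonempty closed convex subset of H, and f : C × C → ℝ a bifunction satisfying conditions (A1)–(A4). Then for every r > 0 and every x ∈ H there exists z ∈ C such that f(z, y) + (1/r)⟨y − z, z − x⟩ ≥ 0 for all y ∈ C. -/

import Mathlib

open scoped RealInnerProductSpace

open Filter Topology Set

section Hilbert

variable {H : Type*} [NormedAddCommGroup H] [InnerProductSpace ℝ H]

theorem isCompact_toWeakSpace_image_closedBall [CompleteSpace H] (R : ℝ) :
    IsCompact (toWeakSpace ℝ H '' Metric.closedBall 0 R) := by
  let Φ : WeakDual ℝ H → WeakSpace ℝ H := fun φ =>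
    toWeakSpace ℝ H ((InnerProductSpace.toDual ℝ H).symm (WeakDual.toStrongDual φ))
  have hΦ : Continuous Φ := by
    refine WeakBilin.continuous_of_continuous_eval _ fun l => ?_
    refine (WeakDual.eval_continuous ((InnerProductSpace.toDual ℝ H).symm l)).congr fun φ => ?_
    change WeakDual.toStrongDual φ _ = l ((InnerProductSpace.toDual ℝ H).symm _)
    rw [← InnerProductSpace.toDual_symm_apply (y := WeakDual.toStrongDual φ),
      ← InnerProductSpace.toDual_symm_apply (y := l), real_inner_comm]
  refine ((WeakDual.isCompact_closedBall (0 : StrongDual ℝ H) R).image hΦ).of_isClosed_subset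
    ?_ ?_
  · rw [← Metric.isClosed_closedBall.closure_eq,
      (convex_closedBall (0 : H) R).toWeakSpace_closure ℝ]
    exact isClosed_closure
  · rintro _ ⟨z, hz, rfl⟩
    refine ⟨StrongDual.toWeakDual (InnerProductSpace.toDual ℝ H z), ?_, ?_⟩
    · simpa using hz
    · simp [Φ]

/-- Closed convex sets with the finite intersection property have a common point as soon as one
of them is bounded. -/
theorem nonempty_iInter_of_isClosed_convex_isBounded [CompleteSpace H] {ι : Type*}
    (K : ι → Set H) (hclosed : ∀ i, IsClosed (K i)) (hconv : ∀ i, Convex ℝ (K i)) (i₀ : ι)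
    (hbdd : Bornology.IsBounded (K i₀))
    (hfin : ∀ u : Finset ι, i₀ ∈ u → (⋂ i ∈ u, K i).Nonempty) : (⋂ i, K i).Nonempty := by
  classical
  obtain ⟨R, hR⟩ := hbdd.subset_closedBall 0
  obtain ⟨w, -, hw⟩ := (isCompact_toWeakSpace_image_closedBall (H := H) R).inter_iInter_nonempty
    (fun i => toWeakSpace ℝ H '' K i)
    (fun i => by
      rw [← (hclosed i).closure_eq, (hconv i).toWeakSpace_closure ℝ]
      exact isClosed_closure)
    (fun u => by
      obtain ⟨z, hz⟩ := hfin (insert i₀ u) (Finset.mem_insert_self _ _)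
      simp only [mem_iInter] at hz
      refine ⟨toWeakSpace ℝ H z,
        mem_image_of_mem _ (hR (hz i₀ (Finset.mem_insert_self _ _))), ?_⟩
      simp only [mem_iInter]
      exact fun i hi => mem_image_of_mem _ (hz i (Finset.mem_insert_of_mem hi)))
  refine ⟨(toWeakSpace ℝ H).symm w, mem_iInter.2 fun i => ?_⟩
  obtain ⟨z, hz, rfl⟩ := mem_iInter.1 hw i
  simpa using hz

theorem convexOn_inner_sub_sub (a b : H) : ConvexOn ℝ univ fun z : H => ⟪z - a, z - b⟫ := by
  refine ⟨convex_univ, fun z _ w _ s t hs ht hst => ?_⟩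
  have key : s * ⟪z - a, z - b⟫ + t * ⟪w - a, w - b⟫ - ⟪s • z + t • w - a, s • z + t • w - b⟫
      = s * t * ⟪z - w, z - w⟫ := by
    obtain rfl : t = 1 - s := by linarith
    simp only [inner_sub_left, inner_sub_right, inner_add_left, inner_add_right,
      real_inner_smul_left, real_inner_smul_right, real_inner_comm z w, real_inner_comm z a,
      real_inner_comm w a]
    ring
  have := mul_nonneg (mul_nonneg hs ht) (real_inner_self_nonneg (x := z - w))
  simp only [smul_eq_mul]
  linarith

theorem convexOn_finset_sum {E ι : Type*} [AddCommGroup E] [Module ℝ E] {s : Set E}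
    (u : Finset ι) (g : ι → E → ℝ) (hs : Convex ℝ s) (hg : ∀ i ∈ u, ConvexOn ℝ s (g i)) :
    ConvexOn ℝ s fun z => ∑ i ∈ u, g i z := by
  classical
  induction u using Finset.induction_on with
  | empty => simpa using convexOn_const (0 : ℝ) hs
  | insert a u ha ih =>
    simp only [Finset.sum_insert ha]
    exact (hg a (Finset.mem_insert_self a u)).add
      (ih fun i hi => hg i (Finset.mem_insert_of_mem hi))

/-- The finite case of the Minty form of the regularized equilibrium problem: only the matrix of
values of the bifunction enters, and the solution is a convex combination of the given points. -/
theorem exists_stdSimplex_minty {ι : Type*} [Fintype ι] [Nonempty ι] (y : ι → H)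
    (M : ι → ι → ℝ) (hM : ∀ i j, M i j + M j i ≤ 0) (x : H) {c : ℝ} (hc : 0 ≤ c) :
    ∃ l ∈ stdSimplex ℝ ι, ∀ i,
      ∑ j, l j * M i j + c * ⟪∑ j, l j • y j - y i, ∑ j, l j • y j - x⟫ ≤ 0 := by
  classical
  let F : (ι → ℝ) → (ι → ℝ) → ℝ := fun l m => ∑ i, m i *
    (∑ j, l j * M i j + c * ⟪∑ j, l j • y j - y i, ∑ j, l j • y j - x⟫)
  have hdiag : ∀ m ∈ stdSimplex ℝ ι, F m m ≤ 0 := by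
    intro m hm
    have hquad : ∑ i, ∑ j, m i * (m j * M i j) ≤ 0 := by
      have hsymm : ∑ i, ∑ j, m i * (m j * M i j) = ∑ i, ∑ j, m i * (m j * M j i) := by
        rw [Finset.sum_comm]
        exact Finset.sum_congr rfl fun i _ => Finset.sum_congr rfl fun j _ => by ring
      have : ∑ i, ∑ j, m i * (m j * M i j) + ∑ i, ∑ j, m i * (m j * M j i) ≤ 0 := by
        simp only [← Finset.sum_add_distrib]
        refine Finset.sum_nonpos fun i _ => Finset.sum_nonpos fun j _ => ?_
        have := mul_nonpos_of_nonneg_of_nonpos (mul_nonneg (hm.1 i) (hm.1 j)) (hM i j)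
        linarith
      linarith
    have hinner : ∑ i, m i * ⟪∑ j, m j • y j - y i, ∑ j, m j • y j - x⟫ = 0 := by
      simp only [← real_inner_smul_left]
      rw [← sum_inner]
      simp only [smul_sub, Finset.sum_sub_distrib, ← Finset.sum_smul, hm.2, one_smul, sub_self,
        inner_zero_left]
    calc F m m = ∑ i, ∑ j, m i * (m j * M i j)
          + c * ∑ i, m i * ⟪∑ j, m j • y j - y i, ∑ j, m j • y j - x⟫ := by
          simp only [F, Finset.mul_sum, mul_add, Finset.sum_add_distrib]
          congr 1
          exact Finset.sum_congr rfl fun i _ => by ring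
      _ ≤ 0 := by rw [hinner]; linarith
  have hne : (stdSimplex ℝ ι).Nonempty :=
    ⟨_, single_mem_stdSimplex ℝ (Classical.arbitrary ι)⟩
  obtain ⟨a, ha, b, hb, hab⟩ := Sion.exists_isSaddlePointOn (X := stdSimplex ℝ ι)
    (Y := stdSimplex ℝ ι) (f := F) hne (convex_stdSimplex ℝ ι) (isCompact_stdSimplex ℝ ι)
    (fun m _ => by
      refine Continuous.continuousOn ?_ |>.lowerSemicontinuousOn
      fun_prop)
    (fun m hm => by
      refine ConvexOn.quasiconvexOn ?_
      refine convexOn_finset_sum Finset.univ _ (convex_stdSimplex ℝ ι) fun i _ => ?_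
      refine ConvexOn.smul (hm.1 i) (ConvexOn.add ?_ (ConvexOn.smul hc ?_))
      · refine ⟨convex_stdSimplex ℝ ι, fun u _ v _ s t _ _ _ => le_of_eq ?_⟩
        simp only [Pi.add_apply, Pi.smul_apply, smul_eq_mul, Finset.mul_sum, add_mul,
          Finset.sum_add_distrib, mul_assoc]
      · have := (convexOn_inner_sub_sub (y i) x).comp_linearMap (Fintype.linearCombination ℝ y)
        exact this.subset (subset_univ _) (convex_stdSimplex ℝ ι))
    (convex_stdSimplex ℝ ι) hne (isCompact_stdSimplex ℝ ι)
    (fun l _ => by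
      refine Continuous.continuousOn ?_ |>.upperSemicontinuousOn
      fun_prop)
    (fun l _ => by
      refine ConcaveOn.quasiconcaveOn
        ⟨convex_stdSimplex ℝ ι, fun u _ v _ s t _ _ _ => le_of_eq ?_⟩
      simp only [F, Pi.add_apply, Pi.smul_apply, smul_eq_mul, Finset.mul_sum, add_mul,
        Finset.sum_add_distrib, mul_assoc])
  refine ⟨a, ha, fun i => ?_⟩
  have := (hab b hb _ (single_mem_stdSimplex ℝ i)).trans (hdiag b hb)
  simpa [F, Pi.single_apply] using this

/-- A convex function that is lower semicontinuous at a zero `y` decreases at most linearly away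
from `y`. -/
theorem ConvexOn.exists_neg_mul_norm_sub_one_le {C : Set H} {g : H → ℝ} (hg : ConvexOn ℝ C g)
    {y : H} (hy : y ∈ C) (hgy : g y = 0) (hlsc : LowerSemicontinuousWithinAt g C y) :
    ∃ k : ℝ, ∀ z ∈ C, -(k * ‖z - y‖) - 1 ≤ g z := by
  obtain ⟨δ, hδ, hball⟩ := Metric.mem_nhdsWithin_iff.1 (hlsc (-1) (show -1 < g y by rw [hgy]; norm_num))
  refine ⟨2 / δ, fun z hz => ?_⟩
  set n := ‖z - y‖ with hn
  have hn0 : 0 ≤ n := norm_nonneg _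
  have hk : 0 ≤ 2 / δ * n := by positivity
  by_cases hlt : n < δ
  · have : -1 < g z := hball ⟨by rwa [Metric.mem_ball, dist_eq_norm], hz⟩
    linarith
  · have hnδ : δ ≤ n := not_lt.1 hlt
    have hnpos : 0 < n := hδ.trans_le hnδ
    set s := δ / (2 * n) with hs
    have hs0 : 0 < s := by positivity
    have hs1 : s ≤ 1 := by rw [hs, div_le_one (by positivity)]; linarith
    have hmem : s • z + (1 - s) • y ∈ C := hg.1 hz hy hs0.le (by linarith) (by ring)
    have hw : -1 < g (s • z + (1 - s) • y) := by
      refine hball ⟨?_, hmem⟩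
      rw [Metric.mem_ball, dist_eq_norm,
        show s • z + (1 - s) • y - y = s • (z - y) by module, norm_smul, Real.norm_eq_abs,
        abs_of_pos hs0, ← hn, hs, show δ / (2 * n) * n = δ / 2 by field_simp]
      linarith
    have hle := hg.2 hz hy hs0.le (by linarith : 0 ≤ 1 - s) (by ring)
    simp only [hgy, smul_eq_mul, mul_zero, add_zero] at hle
    have hkey : s * (2 / δ * n) = 1 := by rw [hs]; field_simp
    have : s * (-(2 / δ * n)) ≤ s * g z := by linarith
    have := le_of_mul_le_mul_left this hs0
    linarith

theorem isBounded_setOf_add_inner_nonpos {C : Set H} {g : H → ℝ} (hg : ConvexOn ℝ C g)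
    {y : H} (hy : y ∈ C) (hgy : g y = 0) (hlsc : LowerSemicontinuousWithinAt g C y)
    (x : H) {c : ℝ} (hc : 0 < c) :
    Bornology.IsBounded {z ∈ C | g z + c * ⟪z - y, z - x⟫ ≤ 0} := by
  obtain ⟨k, hk⟩ := hg.exists_neg_mul_norm_sub_one_le hy hgy hlsc
  refine (Metric.isBounded_closedBall (x := y) (r := ‖y - x‖ + (|k| + 1) / c + 1)).subset ?_
  rintro z ⟨hz, hle⟩
  rw [Metric.mem_closedBall, dist_eq_norm]
  have h1 := hk z hz
  have h2 : ⟪z - y, z - x⟫ = ‖z - y‖ ^ 2 + ⟪z - y, y - x⟫ := by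
    rw [← real_inner_self_eq_norm_sq, ← inner_add_right]; simp
  have h3 := neg_le_of_abs_le (abs_real_inner_le_norm (z - y) (y - x))
  set n := ‖z - y‖
  set d := ‖y - x‖
  have hn0 : 0 ≤ n := norm_nonneg _
  have hd0 : 0 ≤ d := norm_nonneg _
  have h4 : k * n ≤ |k| * n := mul_le_mul_of_nonneg_right (le_abs_self k) hn0
  have h5 : c * (n ^ 2 - n * d) ≤ |k| * n + 1 := by
    have : c * (n ^ 2 - n * d) ≤ c * ⟪z - y, z - x⟫ :=
      mul_le_mul_of_nonneg_left (by linarith) hc.le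
    linarith
  by_contra! hlt
  have hq : 0 < (|k| + 1) / c := by positivity
  have h6 : (|k| + 1) < c * (n - d) := by
    rw [← div_lt_iff₀' hc]; linarith
  have h7 : (|k| + 1) * n ≤ c * (n - d) * n := mul_le_mul_of_nonneg_right h6.le hn0
  nlinarith

theorem isClosed_setOf_add_inner_nonpos {C : Set H} (hC : IsClosed C) {g : H → ℝ}
    (hlsc : LowerSemicontinuousOn g C) (a b : H) (c : ℝ) :
    IsClosed {z ∈ C | g z + c * ⟪z - a, z - b⟫ ≤ 0} := by
  have hcont : Continuous fun z : H => c * ⟪z - a, z - b⟫ := by fun_prop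
  obtain ⟨v, hv, hEq⟩ := lowerSemicontinuousOn_iff_preimage_Iic.1
    (hlsc.add hcont.continuousOn.lowerSemicontinuousOn) 0
  have : {z ∈ C | g z + c * ⟪z - a, z - b⟫ ≤ 0} = C ∩ v := by rw [← hEq]; rfl
  rw [this]
  exact hC.inter hv

theorem convex_setOf_add_inner_nonpos {C : Set H} {g : H → ℝ} (hg : ConvexOn ℝ C g)
    (a b : H) {c : ℝ} (hc : 0 ≤ c) :
    Convex ℝ {z ∈ C | g z + c * ⟪z - a, z - b⟫ ≤ 0} :=
  (hg.add (((convexOn_inner_sub_sub a b).subset (subset_univ _) hg.1).smul hc)).convex_le 0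

theorem exists_minty_solution [CompleteSpace H] {C : Set H} (hCne : C.Nonempty)
    (hCclosed : IsClosed C) {f : H → H → ℝ}
    (hA1 : ∀ x ∈ C, f x x = 0)
    (hA2 : ∀ x ∈ C, ∀ y ∈ C, f x y + f y x ≤ 0)
    (hA4 : ∀ x ∈ C, ConvexOn ℝ C (f x) ∧ LowerSemicontinuousOn (f x) C)
    (x : H) {c : ℝ} (hc : 0 < c) :
    ∃ z ∈ C, ∀ y ∈ C, f y z + c * ⟪z - y, z - x⟫ ≤ 0 := by
  obtain ⟨y₀, hy₀⟩ := hCne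
  obtain ⟨z, hz⟩ := nonempty_iInter_of_isClosed_convex_isBounded
    (fun y : C => {z ∈ C | f y z + c * ⟪z - (y : H), z - x⟫ ≤ 0})
    (fun y => isClosed_setOf_add_inner_nonpos hCclosed (hA4 y y.2).2 _ _ _)
    (fun y => convex_setOf_add_inner_nonpos (hA4 y y.2).1 _ _ hc.le)
    ⟨y₀, hy₀⟩
    (isBounded_setOf_add_inner_nonpos (hA4 y₀ hy₀).1 hy₀ (hA1 y₀ hy₀) ((hA4 y₀ hy₀).2 y₀ hy₀) x hc)
    (fun u hu => by
      have : Nonempty u := ⟨⟨_, hu⟩⟩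
      obtain ⟨l, hl, hle⟩ := exists_stdSimplex_minty (fun i : u => (i.1 : H))
        (fun i j => f i.1 j.1) (fun i j => hA2 _ i.1.2 _ j.1.2) x hc.le
      refine ⟨∑ j : u, l j • (j.1 : H), mem_iInter₂.2 fun y hy => ⟨?_, ?_⟩⟩
      · exact (hA4 y₀ hy₀).1.1.sum_mem (fun j _ => hl.1 j) hl.2 fun j _ => j.1.2
      · have h1 := (hA4 y y.2).1.map_sum_le (t := Finset.univ) (w := l)
          (p := fun j : u => (j.1 : H)) (fun j _ => hl.1 j) hl.2 fun j _ => j.1.2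
        have h2 := hle ⟨y, hy⟩
        simp only [smul_eq_mul] at h1
        linarith)
  rw [mem_iInter] at hz
  exact ⟨z, (hz ⟨y₀, hy₀⟩).1, fun y hy => (hz ⟨y, hy⟩).2⟩

theorem equilibrium_of_minty {C : Set H} {f : H → H → ℝ}
    (hA1 : ∀ x ∈ C, f x x = 0)
    (hA2 : ∀ x ∈ C, ∀ y ∈ C, f x y + f y x ≤ 0)
    (hA3 : ∀ x ∈ C, ∀ y ∈ C, ∀ z ∈ C,
      limsup (fun t : ℝ => f (t • z + (1 - t) • x) y) (𝓝[>] 0) ≤ f x y)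
    (hA4 : ∀ x ∈ C, ConvexOn ℝ C (f x) ∧ LowerSemicontinuousOn (f x) C)
    {x z : H} {c : ℝ} (hz : z ∈ C) (hminty : ∀ y ∈ C, f y z + c * ⟪z - y, z - x⟫ ≤ 0)
    {y : H} (hy : y ∈ C) : 0 ≤ f z y + c * ⟪y - z, z - x⟫ := by
  set p : ℝ → H := fun t => t • y + (1 - t) • z with hp
  set q := c * ⟪z - y, z - x⟫ with hq
  have ht : ∀ᶠ t : ℝ in 𝓝[>] 0, t ∈ Ioo (0 : ℝ) 1 := Ioo_mem_nhdsGT one_pos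
  have hpC : ∀ t ∈ Ioo (0 : ℝ) 1, p t ∈ C := fun t ht =>
    (hA4 y hy).1.1 hy hz ht.1.le (by linarith [ht.2]) (by ring)
  have hlower : ∀ t ∈ Ioo (0 : ℝ) 1, (1 - t) * q ≤ f (p t) y := by
    intro t ht
    have h1 := (hA4 _ (hpC t ht)).1.2 hy hz ht.1.le (by linarith [ht.2] : 0 ≤ 1 - t) (by ring)
    have h2 := hminty _ (hpC t ht)
    have h3 : c * ⟪z - p t, z - x⟫ = t * q := by
      rw [show z - p t = t • (z - y) by simp only [hp]; module, real_inner_smul_left, hq]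
      ring
    rw [h3] at h2
    rw [show t • y + (1 - t) • z = p t from rfl, hA1 _ (hpC t ht)] at h1
    simp only [smul_eq_mul] at h1
    have h4 := mul_le_mul_of_nonneg_left h2 (by linarith [ht.2] : 0 ≤ 1 - t)
    have h5 : t * ((1 - t) * q) ≤ t * f (p t) y := by linarith
    exact le_of_mul_le_mul_left h5 ht.1
  have hcont : Tendsto p (𝓝[>] 0) (𝓝 z) := by
    have : Continuous p := by fun_prop
    simpa [hp] using (this.tendsto 0).mono_left nhdsWithin_le_nhds
  have hbdd : IsBoundedUnder (· ≤ ·) (𝓝[>] 0) fun t => f (p t) y := by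
    have hev := (tendsto_nhdsWithin_iff.2 ⟨hcont, ht.mono hpC⟩).eventually
      ((hA4 y hy).2 z hz (f y z - 1) (by linarith))
    refine isBoundedUnder_of_eventually_le (a := 1 - f y z) ?_
    filter_upwards [hev, ht] with t h1 h2
    have := hA2 _ (hpC t h2) _ hy
    linarith
  have hlim : Tendsto (fun t : ℝ => (1 - t) * q) (𝓝[>] 0) (𝓝 q) := by
    have : Continuous fun t : ℝ => (1 - t) * q := by fun_prop
    simpa using (this.tendsto 0).mono_left nhdsWithin_le_nhds
  have hfq : q ≤ f z y := by
    refine le_of_forall_lt fun e he => ?_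
    obtain ⟨e', he', heq⟩ := exists_between he
    refine he'.trans_le (le_trans ?_ (hA3 z hz y hy y hy))
    refine le_limsup_of_frequently_le (Eventually.frequently ?_) hbdd
    filter_upwards [hlim.eventually (lt_mem_nhds heq), ht] with t h1 h2
    exact h1.le.trans (hlower t h2)
  have : c * ⟪y - z, z - x⟫ = -q := by
    rw [hq, ← neg_sub z y, inner_neg_left]; ring
  linarith

end Hilbert

/-- Blum–Oettli resolvent existence, Hilbert-space case: if `f` satisfies
conditions (A1)–(A4) on a nonempty closed convex set `C`, then for every `r > 0` and `x ∈ H`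
there exists `z ∈ C` with `f z y + (1/r)⟨y - z, z - x⟩ ≥ 0` for all `y ∈ C`. -/
theorem statement1 (H : Type*) [NormedAddCommGroup H] [InnerProductSpace ℝ H] [CompleteSpace H]
    (C : Set H) (hCne : C.Nonempty) (hCclosed : IsClosed C) (hCconv : Convex ℝ C)
    (f : H → H → ℝ)
    (hA1 : ∀ x ∈ C, f x x = 0)
    (hA2 : ∀ x ∈ C, ∀ y ∈ C, f x y + f y x ≤ 0)
    (hA3 : ∀ x ∈ C, ∀ y ∈ C, ∀ z ∈ C,
      Filter.limsup (fun t : ℝ => f (t • z + (1 - t) • x) y) (nhdsWithin 0 (Set.Ioi 0)) ≤ f x y)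
    (hA4 : ∀ x ∈ C, ConvexOn ℝ C (f x) ∧ LowerSemicontinuousOn (f x) C)
    (r : ℝ) (hr : 0 < r) (x : H) :
    ∃ z ∈ C, ∀ y ∈ C, 0 ≤ f z y + (1 / r) * ⟪y - z, z - x⟫ := by
  obtain ⟨z, hz, hminty⟩ :=
    exists_minty_solution hCne hCclosed hA1 hA2 hA4 x (one_div_pos.2 hr)
  exact ⟨z, hz, fun y hy => equilibrium_of_minty hA1 hA2 hA3 hA4 hz hminty hy⟩
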